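/- arXiv:2510.20600 — 2 statements merged into one kernel-verified Lean document; each statement's English description precedes it below -/
import Mathlib

section
/- Let S be a finite index set and p : S → ℝ with 0 ≤ p(s) ≤ 1 for all s ∈ S. Then 1 - ∏_{s ∈ S} (1 - p(s)) ≥ (1 - 1/e) · min(1, ∑_{s ∈ S} p(s)), where e is Euler's number. (Hence the nonlinear coverage probability loses at most a factor (1 - 1/e) relative to the LP surrogate value.) -/
open Finset

/-- On `[0, 1]`, `exp (-x)` lies below its chord. -/
theorem exp_neg_le_one_sub_mul {x : ℝ} (hx0 : 0 ≤ x) (hx1 : x ≤ 1) :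
    Real.exp (-x) ≤ 1 - (1 - 1 / Real.exp 1) * x := by
  have h := convexOn_exp.2 (Set.mem_univ 0) (Set.mem_univ (-1))
    (sub_nonneg.2 hx1) hx0 (sub_add_cancel 1 x)
  simp only [smul_eq_mul, mul_zero, zero_add, mul_neg, mul_one, Real.exp_zero,
    Real.exp_neg] at h
  rw [Real.exp_neg, one_div]
  linarith

/-- The coverage probability loses at most a factor `(1 - 1/e)` relative to the
    LP surrogate: `1 - ∏_{s ∈ S} (1 - p(s)) ≥ (1 - 1/e) · min(1, ∑_{s ∈ S} p(s))`. -/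
theorem coverage_ge_one_sub_inv_e_mul_surrogate {α : Type*} (S : Finset α)
    (p : α → ℝ) (hp : ∀ s ∈ S, 0 ≤ p s ∧ p s ≤ 1) :
    (1 - 1 / Real.exp 1) * min 1 (∑ s ∈ S, p s)
      ≤ 1 - ∏ s ∈ S, (1 - p s) := by
  have hprod : ∏ s ∈ S, (1 - p s) ≤ Real.exp (-∑ s ∈ S, p s) := by
    rw [← Finset.sum_neg_distrib, Real.exp_sum]
    exact Finset.prod_le_prod (fun s hs => sub_nonneg.2 (hp s hs).2)
      (fun s _ => Real.one_sub_le_exp_neg (p s))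
  have hmono : Real.exp (-∑ s ∈ S, p s) ≤ Real.exp (-min 1 (∑ s ∈ S, p s)) :=
    Real.exp_le_exp.2 (neg_le_neg (min_le_right _ _))
  have hchord := exp_neg_le_one_sub_mul
    (le_min zero_le_one (Finset.sum_nonneg fun s hs => (hp s hs).1))
    (min_le_left 1 (∑ s ∈ S, p s))
  linarith
end

section
/- Let BS be a finite set of slots and, for a fixed user u and product i, let p : BS → [0,1] and x : BS → [0,1]. Suppose each slot s is independently assigned to product i with probability x(s), and let S_i be the random assigned set. Then the expected coverage probability of u satisfies E[1 - ∏_{s ∈ S_i} (1 - p(s))] = 1 - ∏_{s ∈ BS} (1 - p(s)·x(s)) ≥ (1 - 1/e) · min(1, ∑_{s ∈ BS} p(s)·x(s)). In particular, if y ∈ [0,1] satisfies the LP linking constraint y ≤ ∑_{s ∈ BS} p(s)·x(s), then the expected coverage of u is at least (1 - 1/e)·y. -/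
open Finset

/-- The expectation of `1 - ∏ s ∈ T, (1 - p s)` over the random set `T` that contains each `s`
independently with probability `x s`. -/
theorem sum_prod_mul_one_sub_prod {ι R : Type*} [Fintype ι] [DecidableEq ι] [CommRing R]
    (p x : ι → R) :
    (∑ T : Finset ι,
        ((∏ s ∈ T, x s) * (∏ s ∈ Tᶜ, (1 - x s))) * (1 - ∏ s ∈ T, (1 - p s)))
      = 1 - ∏ s : ι, (1 - p s * x s) := by
  have total : ∑ T : Finset ι, (∏ s ∈ T, x s) * (∏ s ∈ Tᶜ, (1 - x s)) = 1 := by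
    rw [← Fintype.prod_add]
    simp
  have uncovered : ∑ T : Finset ι,
      ((∏ s ∈ T, x s) * (∏ s ∈ Tᶜ, (1 - x s))) * ∏ s ∈ T, (1 - p s)
        = ∏ s : ι, (1 - p s * x s) := by
    calc _ = ∑ T : Finset ι, (∏ s ∈ T, x s * (1 - p s)) * ∏ s ∈ Tᶜ, (1 - x s) := by
          refine Finset.sum_congr rfl fun T _ => ?_
          rw [Finset.prod_mul_distrib]
          ring
      _ = ∏ s : ι, (x s * (1 - p s) + (1 - x s)) := (Fintype.prod_add _ _).symm
      _ = _ := Finset.prod_congr rfl fun s _ => by ring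
  simp only [mul_sub, mul_one, Finset.sum_sub_distrib, total, uncovered]

theorem Finset.prod_one_sub_le_exp_neg_sum {ι : Type*} (t : Finset ι) (z : ι → ℝ)
    (hz : ∀ s ∈ t, z s ≤ 1) : ∏ s ∈ t, (1 - z s) ≤ Real.exp (-∑ s ∈ t, z s) := by
  rw [← Finset.sum_neg_distrib, Real.exp_sum]
  exact Finset.prod_le_prod (fun s hs => sub_nonneg.2 (hz s hs))
    fun s _ => Real.one_sub_le_exp_neg (z s)

/-- On `[0, 1]`, `exp (-m)` lies below its chord. -/
theorem Real.one_sub_inv_exp_one_mul_le {m : ℝ} (h0 : 0 ≤ m) (h1 : m ≤ 1) :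
    (1 - 1 / Real.exp 1) * m ≤ 1 - Real.exp (-m) := by
  have h := convexOn_exp.2 (Set.mem_univ 0) (Set.mem_univ (-1)) (sub_nonneg.2 h1) h0
    (sub_add_cancel 1 m)
  simp only [smul_eq_mul, mul_zero, zero_add, mul_neg, mul_one, Real.exp_zero, Real.exp_neg 1] at h
  rw [one_div]
  linarith

/-- The bound `1 - 1/e` for any fractional value `y` below the total weight. -/
theorem one_sub_inv_exp_one_mul_le_one_sub_prod {ι : Type*} (t : Finset ι) (z : ι → ℝ)
    (hz : ∀ s ∈ t, z s ≤ 1) {y : ℝ} (h0 : 0 ≤ y) (h1 : y ≤ 1) (hy : y ≤ ∑ s ∈ t, z s) :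
    (1 - 1 / Real.exp 1) * y ≤ 1 - ∏ s ∈ t, (1 - z s) :=
  (Real.one_sub_inv_exp_one_mul_le h0 h1).trans <| sub_le_sub_left
    ((t.prod_one_sub_le_exp_neg_sum z hz).trans (Real.exp_le_exp.2 (neg_le_neg hy))) 1

/-- Expected coverage of a user under independent per-slot randomized rounding:
    it equals `1 - ∏_{s ∈ BS} (1 - p(s)·x(s))`, is at least
    `(1 - 1/e) · min(1, ∑_s p(s)·x(s))`, and hence whenever `y ∈ [0,1]`
    satisfies the LP linking constraint `y ≤ ∑_s p(s)·x(s)`, the expected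
    coverage is at least `(1 - 1/e) · y`. -/
theorem expected_coverage_approx {BS : Type*} [Fintype BS] [DecidableEq BS]
    (p x : BS → ℝ) (hp : ∀ s, 0 ≤ p s ∧ p s ≤ 1) (hx : ∀ s, 0 ≤ x s ∧ x s ≤ 1) :
    ((∑ T : Finset BS,
        ((∏ s ∈ T, x s) * (∏ s ∈ Tᶜ, (1 - x s)))
          * (1 - ∏ s ∈ T, (1 - p s)))
      = 1 - ∏ s : BS, (1 - p s * x s))
    ∧ ((1 - 1 / Real.exp 1) * min 1 (∑ s : BS, p s * x s)
        ≤ 1 - ∏ s : BS, (1 - p s * x s))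
    ∧ (∀ y : ℝ, 0 ≤ y → y ≤ 1 → y ≤ ∑ s : BS, p s * x s →
        (1 - 1 / Real.exp 1) * y
          ≤ ∑ T : Finset BS,
              ((∏ s ∈ T, x s) * (∏ s ∈ Tᶜ, (1 - x s)))
                * (1 - ∏ s ∈ T, (1 - p s))) := by
  have bound : ∀ y : ℝ, 0 ≤ y → y ≤ 1 → y ≤ ∑ s : BS, p s * x s →
      (1 - 1 / Real.exp 1) * y ≤ 1 - ∏ s : BS, (1 - p s * x s) := fun y h0 h1 hy =>
    one_sub_inv_exp_one_mul_le_one_sub_prod univ _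
      (fun s _ => mul_le_one₀ (hp s).2 (hx s).1 (hx s).2) h0 h1 hy
  rw [sum_prod_mul_one_sub_prod]
  have nonneg : 0 ≤ ∑ s : BS, p s * x s :=
    Finset.sum_nonneg fun s _ => mul_nonneg (hp s).1 (hx s).1
  exact ⟨rfl, bound _ (le_min zero_le_one nonneg) (min_le_left _ _) (min_le_right _ _), bound⟩
end
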